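/- Let s ∈ ℤ with s ≠ −1 and assume q^{s+1} ≠ 1 and q^{s+1} ≠ −1. Then every odd q-derivation φ of 𝔄_q homogeneous of degree s is inner: φ is a linear combination of ad_{G_s} and ad_{T_s}, i.e. the space of odd q-derivations of degree s equals the span of ad_{G_s} and ad_{T_s}. -/

import Mathlib

open Finsupp

/-- Index type for the basis of the q-deformed Heisenberg-Virasoro superalgebra:
`L m, I m` (even), `G m, T m` (odd), for `m ∈ ℤ`. -/
inductive BIdx : Type
  | L : ℤ → BIdx
  | I : ℤ → BIdx
  | G : ℤ → BIdx
  | T : ℤ → BIdx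
  deriving DecidableEq

/-- The underlying super vector space `𝔄_q`: the free `ℂ`-module on the basis `BIdx`. -/
abbrev Aq : Type := BIdx →₀ ℂ

/-- Parity of the basis elements: `L, I` even (`false`), `G, T` odd (`true`). -/
def BIdx.parity : BIdx → Bool
  | .L _ => false
  | .I _ => false
  | .G _ => true
  | .T _ => true

/-- The `q`-number `{n} = (1 - qⁿ)/(1 - q)`. -/
noncomputable def qnum (q : ℂ) (n : ℤ) : ℂ := (1 - q ^ n) / (1 - q)

/-- The bracket `[·,·]_q` on basis elements (extended by super-skew-symmetry). -/
noncomputable def bk (q : ℂ) : BIdx → BIdx → Aq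
  | .L m, .L n => single (.L (m + n)) (qnum q m - qnum q n)
  | .L m, .I n => single (.I (m + n)) (-(qnum q n))
  | .I m, .L n => single (.I (m + n)) (qnum q m)
  | .L m, .G n => single (.G (m + n)) (qnum q m - qnum q (n + 1))
  | .G m, .L n => single (.G (m + n)) (qnum q (m + 1) - qnum q n)
  | .I m, .G n => single (.T (m + n)) (qnum q m)
  | .G m, .I n => single (.T (m + n)) (-(qnum q n))
  | .L m, .T n => single (.T (m + n)) (-(qnum q (n + 1)))
  | .T m, .L n => single (.T (m + n)) (qnum q (m + 1))
  | _, _ => 0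

/-- Bilinear extension of the bracket `[·,·]_q` to all of `𝔄_q`. -/
noncomputable def bkA (q : ℂ) (x y : Aq) : Aq :=
  x.sum fun i a => y.sum fun j b => (a * b) • bk q i j

/-- The eigenvalue of the twist map `α_q` on each basis element. -/
noncomputable def acoef (q : ℂ) : BIdx → ℂ
  | .L n => 1 + q ^ n
  | .I n => 1 + q ^ n
  | .G n => 1 + q ^ (n + 1)
  | .T n => 1 + q ^ (n + 1)

/-- The even linear twist map `α_q` of `𝔄_q`. -/
noncomputable def alq (q : ℂ) (x : Aq) : Aq :=
  x.sum fun i a => single i (acoef q i * a)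

/-- `x` is homogeneous of parity `p`. -/
def homOf (p : Bool) (x : Aq) : Prop := ∀ i ∈ x.support, BIdx.parity i = p

/-- The sign `(−1)^{|x||y|}` for parities `a`, `b`. -/
noncomputable def sgn (a b : Bool) : ℂ := if a && b then -1 else 1

/-- The span of the basis elements `L_n, I_n`. -/
noncomputable def spanLI (n : ℤ) : Submodule ℂ Aq :=
  Submodule.span ℂ {single (BIdx.L n) (1 : ℂ), single (BIdx.I n) (1 : ℂ)}

/-- The span of the basis elements `G_n, T_n`. -/
noncomputable def spanGT (n : ℤ) : Submodule ℂ Aq :=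
  Submodule.span ℂ {single (BIdx.G n) (1 : ℂ), single (BIdx.T n) (1 : ℂ)}

/-- The linear extension of a map `D` given by its values on the basis. -/
noncomputable def DA (D : BIdx → Aq) (x : Aq) : Aq := x.sum fun i a => a • D i

/-- The sign `(−1)^{|x|}` for a parity `b`. -/
noncomputable def sgn1 (b : Bool) : ℂ := if b then -1 else 1

/-- An even `q`-derivation of `𝔄_q` homogeneous of degree `s`:
an even linear map of degree `s` with
`φ([x,y]_q) = (1+q^s)⁻¹ ([φ x, α_q y]_q + [α_q x, φ y]_q)` for homogeneous `x, y`. -/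
def IsEvenQDerivation (q : ℂ) (s : ℤ) (φ : BIdx → Aq) : Prop :=
  (∀ n : ℤ, φ (.L n) ∈ spanLI (n + s) ∧ φ (.I n) ∈ spanLI (n + s) ∧
      φ (.G n) ∈ spanGT (n + s) ∧ φ (.T n) ∈ spanGT (n + s)) ∧
  ∀ (px py : Bool) (x y : Aq), homOf px x → homOf py y →
    DA φ (bkA q x y) =
      (1 + q ^ s)⁻¹ • (bkA q (DA φ x) (alq q y) + bkA q (alq q x) (DA φ y))

/-- An odd `q`-derivation of `𝔄_q` homogeneous of degree `s`:
an odd linear map of degree `s` with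
`φ([x,y]_q) = (1+q^{s+1})⁻¹ ([φ x, α_q y]_q + (−1)^{|x|}[α_q x, φ y]_q)`
for homogeneous `x, y`. -/
def IsOddQDerivation (q : ℂ) (s : ℤ) (φ : BIdx → Aq) : Prop :=
  (∀ n : ℤ, φ (.L n) ∈ spanGT (n + s) ∧ φ (.I n) ∈ spanGT (n + s) ∧
      φ (.G n) ∈ spanLI (n + s) ∧ φ (.T n) ∈ spanLI (n + s)) ∧
  ∀ (px py : Bool) (x y : Aq), homOf px x → homOf py y →
    DA φ (bkA q x y) =
      (1 + q ^ (s + 1))⁻¹ •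
        (bkA q (DA φ x) (alq q y) + sgn1 px • bkA q (alq q x) (DA φ y))

section Aux

lemma bkA_add_left (q : ℂ) (x x' y : Aq) : bkA q (x + x') y = bkA q x y + bkA q x' y := by
  unfold bkA
  rw [Finsupp.sum_add_index']
  · intro i; simp
  · intro i a b
    rw [← Finsupp.sum_add]
    congr 1; funext j c; rw [add_mul, add_smul]

lemma bkA_add_right (q : ℂ) (x y y' : Aq) : bkA q x (y + y') = bkA q x y + bkA q x y' := by
  unfold bkA
  rw [← Finsupp.sum_add]
  congr 1; funext i a
  rw [Finsupp.sum_add_index']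
  · intro i; simp
  · intro j b c
    rw [mul_add, add_smul]

lemma bkA_single (q : ℂ) (i j : BIdx) (a b : ℂ) :
    bkA q (single i a) (single j b) = (a * b) • bk q i j := by
  unfold bkA
  rw [Finsupp.sum_single_index, Finsupp.sum_single_index] <;> simp

lemma bkA_zero_left (q : ℂ) (y : Aq) : bkA q 0 y = 0 := by simp [bkA]

lemma bkA_zero_right (q : ℂ) (y : Aq) : bkA q y 0 = 0 := by simp [bkA]

lemma DA_add (D : BIdx → Aq) (x y : Aq) : DA D (x + y) = DA D x + DA D y := by
  unfold DA
  rw [Finsupp.sum_add_index']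
  · intro i; simp
  · intro i a b; rw [add_smul]

lemma DA_single (D : BIdx → Aq) (i : BIdx) (a : ℂ) : DA D (single i a) = a • D i := by
  unfold DA
  rw [Finsupp.sum_single_index]; simp

lemma DA_zero (D : BIdx → Aq) : DA D 0 = 0 := by simp [DA]

lemma alq_add (q : ℂ) (x y : Aq) : alq q (x + y) = alq q x + alq q y := by
  unfold alq
  rw [Finsupp.sum_add_index']
  · intro i; simp
  · intro i a b; rw [mul_add, single_add]

lemma alq_single (q : ℂ) (i : BIdx) (a : ℂ) : alq q (single i a) = single i (acoef q i * a) := by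
  unfold alq
  rw [Finsupp.sum_single_index]; simp

lemma alq_zero (q : ℂ) : alq q 0 = 0 := by simp [alq]

lemma mem_spanLI {n : ℤ} {x : Aq} : x ∈ spanLI n ↔
    ∃ a b : ℂ, x = single (.L n) a + single (.I n) b := by
  unfold spanLI
  rw [Submodule.mem_span_pair]
  simp only [smul_single, smul_eq_mul, mul_one, eq_comm]

lemma mem_spanGT {n : ℤ} {x : Aq} : x ∈ spanGT n ↔
    ∃ a b : ℂ, x = single (.G n) a + single (.T n) b := by
  unfold spanGT
  rw [Submodule.mem_span_pair]
  simp only [smul_single, smul_eq_mul, mul_one, eq_comm]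

lemma der_of_basis_right (q k : ℂ) (φ : BIdx → Aq)
    (h : ∀ (i j : BIdx) (a b : ℂ), DA φ (bkA q (single i a) (single j b)) =
      k • (bkA q (DA φ (single i a)) (alq q (single j b)) +
        sgn1 i.parity • bkA q (alq q (single i a)) (DA φ (single j b))))
    (i : BIdx) (a : ℂ) (y : Aq) :
    DA φ (bkA q (single i a) y) = k • (bkA q (DA φ (single i a)) (alq q y) +
        sgn1 i.parity • bkA q (alq q (single i a)) (DA φ y)) := by
  induction y using Finsupp.induction_linear with
  | zero => simp [bkA_zero_right, DA_zero, alq_zero]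
  | add y z hy hz =>
    rw [bkA_add_right, DA_add, hy, hz, alq_add, DA_add φ y z, bkA_add_right, bkA_add_right]
    simp only [smul_add]; abel
  | single j b => rw [h]

/-- Reduction of the derivation identity to basis elements. -/
lemma der_of_basis (q k : ℂ) (φ : BIdx → Aq)
    (h : ∀ (i j : BIdx) (a b : ℂ), DA φ (bkA q (single i a) (single j b)) =
      k • (bkA q (DA φ (single i a)) (alq q (single j b)) +
        sgn1 i.parity • bkA q (alq q (single i a)) (DA φ (single j b))))
    (px : Bool) (x y : Aq) (hx : homOf px x) :
    DA φ (bkA q x y) = k • (bkA q (DA φ x) (alq q y) + sgn1 px • bkA q (alq q x) (DA φ y)) := by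
  induction x using Finsupp.induction with
  | zero => simp [bkA_zero_left, DA_zero, alq_zero]
  | single_add i a f hi ha ih =>
    have hsupp : (single i a + f).support = insert i f.support := by
      rw [Finsupp.support_single_add hi ha, Finset.cons_eq_insert]
    have hip : i.parity = px := hx i (by rw [hsupp]; simp)
    have hf : homOf px f := fun j hj => hx j (by rw [hsupp]; simp [hj])
    have key : DA φ (bkA q (single i a) y) = k • (bkA q (DA φ (single i a)) (alq q y) +
        sgn1 px • bkA q (alq q (single i a)) (DA φ y)) := by
      rw [← hip]; exact der_of_basis_right q k φ h i a y
    rw [bkA_add_left, DA_add, key, ih hf, DA_add, alq_add, bkA_add_left, bkA_add_left]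
    simp only [smul_add]; abel

end Aux

section Scalar

variable {q : ℂ} {s : ℤ}

lemma scal_a (hq0 : q ≠ 0) {S : ℂ} (hS : q ^ (s + 1) = S) (h1 : S ≠ 1) (h2 : S ≠ -1) (hS0 : S ≠ 0)
    (a : ℤ → ℂ) (H : ∀ m n, (1 + S) * (q ^ n - q ^ m) * a (m + n) =
      (1 + q ^ n) * a m * (q ^ n - q ^ m * S) + (1 + q ^ m) * a n * (q ^ n * S - q ^ m)) (n : ℤ) :
    a n * (1 - S) = a 0 * (q ^ n - S) := by
  have hp : 1 + S ≠ 0 := fun h => h2 (by linear_combination h)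
  have key : ∀ n : ℤ, q ^ n ≠ -1 → a n * (1 - S) = a 0 * (q ^ n - S) := by
    intro n hn
    have := H 0 n
    simp only [zpow_zero, zero_add] at this
    have h3 : 1 + q ^ n ≠ 0 := fun h => hn (by linear_combination h)
    apply mul_left_cancel₀ h3
    linear_combination this
  by_cases hn : q ^ n = -1
  · have hE := H (s + 1) n
    have hk := key (s + 1 + n) (by rw [zpow_add₀ hq0, hS, hn]; intro h; exact h1 (by linear_combination -h))
    rw [zpow_add₀ hq0, hS, hn] at hk
    rw [hS, hn] at hE
    rw [hn]
    apply mul_left_cancel₀ (mul_ne_zero (mul_ne_zero hp hS0) two_ne_zero)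
    linear_combination (1 - S) * hE + (1 + S) ^ 2 * hk
  · exact key n hn

lemma scal_b (hq0 : q ≠ 0) {S : ℂ} (hS : q ^ (s + 1) = S) (h1 : S ≠ 1) (h2 : S ≠ -1)
    (b : ℤ → ℂ) (H : ∀ m n, (1 + S) * (q ^ n - q ^ m) * b (m + n) =
      (1 + q ^ n) * b m * (1 - q ^ m * S) - (1 + q ^ m) * b n * (1 - q ^ n * S)) (n : ℤ) :
    b n = b 0 := by
  have hp : 1 + S ≠ 0 := fun h => h2 (by linear_combination h)
  have hm : 1 - S ≠ 0 := fun h => h1 (by linear_combination -h)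
  have key : ∀ n : ℤ, q ^ n ≠ -1 → b n = b 0 := by
    intro n hn
    have := H 0 n
    simp only [zpow_zero, zero_add] at this
    have h3 : 1 + q ^ n ≠ 0 := fun h => hn (by linear_combination h)
    apply mul_left_cancel₀ (mul_ne_zero h3 hm)
    linear_combination this
  by_cases hn : q ^ n = -1
  · have hE := H (s + 1) n
    have hk := key (s + 1 + n) (by rw [zpow_add₀ hq0, hS, hn]; intro h; exact h1 (by linear_combination -h))
    rw [hS, hn] at hE
    apply mul_left_cancel₀ (mul_ne_zero hp hp)
    linear_combination hE + (1 + S) ^ 2 * hk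
  · exact key n hn

lemma scal_c (hq0 : q ≠ 0) {S : ℂ} (hS : q ^ (s + 1) = S) (h1 : S ≠ 1) (h2 : S ≠ -1) (hS0 : S ≠ 0)
    (c : ℤ → ℂ) (H : ∀ m n, -((1 + S) * (1 - q ^ n)) * c (m + n) =
      (1 + q ^ m) * c n * (q ^ n * S - q ^ m)) (n : ℤ) :
    c n = 0 := by
  have hp : 1 + S ≠ 0 := fun h => h2 (by linear_combination h)
  have hm : 1 - S ≠ 0 := fun h => h1 (by linear_combination -h)
  have key : ∀ n : ℤ, q ^ n ≠ -1 → c n = 0 := by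
    intro n hn
    have := H 0 n
    simp only [zpow_zero, zero_add] at this
    have h3 : 1 + q ^ n ≠ 0 := fun h => hn (by linear_combination h)
    apply mul_left_cancel₀ (mul_ne_zero h3 hm)
    linear_combination this
  by_cases hn : q ^ n = -1
  · have hE := H (s + 1) n
    have hk := key (s + 1 + n) (by rw [zpow_add₀ hq0, hS, hn]; intro h; exact h1 (by linear_combination -h))
    rw [hS, hn, hk] at hE
    apply mul_left_cancel₀ (mul_ne_zero (mul_ne_zero hp hS0) two_ne_zero)
    linear_combination hE
  · exact key n hn

lemma scal_d (hq0 : q ≠ 0) {S : ℂ} (hS : q ^ (s + 1) = S) (h1 : S ≠ 1) (h2 : S ≠ -1)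
    (a d : ℤ → ℂ)
    (H : ∀ m n, -((1 + S) * (1 - q ^ n)) * d (m + n) =
      -((1 + q ^ n) * a m * (1 - q ^ n)) - (1 + q ^ m) * d n * (1 - q ^ n * S)) (n : ℤ) :
    d n * (1 - S) = -(a 0 * (1 - q ^ n)) := by
  have hp : 1 + S ≠ 0 := fun h => h2 (by linear_combination h)
  have hm : 1 - S ≠ 0 := fun h => h1 (by linear_combination -h)
  have key : ∀ n : ℤ, q ^ n ≠ -1 → d n * (1 - S) = -(a 0 * (1 - q ^ n)) := by
    intro n hn
    have := H 0 n
    simp only [zpow_zero, zero_add] at this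
    have h3 : 1 + q ^ n ≠ 0 := fun h => hn (by linear_combination h)
    apply mul_left_cancel₀ h3
    linear_combination this
  by_cases hn : q ^ n = -1
  · have hE := H (s + 1) n
    have hk := key (s + 1 + n) (by rw [zpow_add₀ hq0, hS, hn]; intro h; exact h1 (by linear_combination -h))
    rw [zpow_add₀ hq0, hS, hn] at hk
    rw [hS, hn] at hE
    rw [hn]
    apply mul_left_cancel₀ (mul_ne_zero hp hp)
    linear_combination (1 - S) * hE + 2 * (1 + S) * hk
  · exact key n hn

lemma scal_e (hq0 : q ≠ 0) {S R : ℂ} (hS : q ^ (s + 1) = S)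
    (h1 : S ≠ 1) (h2 : S ≠ -1) (hS0 : S ≠ 0)
    (e : ℤ → ℂ) (H : ∀ m n, (1 + S) * (q ^ n * q - q ^ m) * e (m + n) =
      (1 + q ^ m) * e n * (q ^ n * R - q ^ m)) (n : ℤ) :
    e n = 0 := by
  have hp : 1 + S ≠ 0 := fun h => h2 (by linear_combination h)
  have hm : 1 - S ≠ 0 := fun h => h1 (by linear_combination -h)
  have key : ∀ n : ℤ, (q ^ n * ((1 + S) * q - 2 * R) + 1 - S) * e n = 0 := by
    intro n
    have := H 0 n
    simp only [zpow_zero, zero_add] at this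
    linear_combination this
  by_contra hn
  have hK : q ^ n * ((1 + S) * q - 2 * R) + 1 - S = 0 := (mul_eq_zero.1 (key n)).resolve_right hn
  have e1 : e (s + 1 + n) = 0 := by
    refine (mul_eq_zero.1 (key _)).resolve_left fun h => ?_
    rw [zpow_add₀ hq0, hS] at h
    exact mul_ne_zero hm hm (by linear_combination h - S * hK)
  have e2 : e (-(s + 1) + n) = 0 := by
    refine (mul_eq_zero.1 (key _)).resolve_left fun h => ?_
    rw [zpow_add₀ hq0, zpow_neg, hS] at h
    field_simp at h
    exact mul_ne_zero hm hm (by linear_combination hK - h)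
  have f1 := H (s + 1) n
  have f2 := H (-(s + 1)) n
  rw [e1, hS] at f1
  rw [e2, zpow_neg, hS] at f2
  have g1 : q ^ n * R - S = 0 := by
    apply mul_left_cancel₀ (mul_ne_zero hp hn); linear_combination -f1
  have g2 : (1 + S) * e n * (q ^ n * R * S - 1) = 0 := by
    field_simp at f2; linear_combination -f2
  have g3 : q ^ n * R * S - 1 = 0 := by
    apply mul_left_cancel₀ (mul_ne_zero hp hn); linear_combination g2
  exact mul_ne_zero hm hp (by linear_combination S * g1 - g3)

lemma scal_f (hq0 : q ≠ 0) (hq1 : q ≠ 1) {S R : ℂ} (hS : q ^ (s + 1) = S) (hR : S = R * q)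
    (h1 : S ≠ 1) (h2 : S ≠ -1)
    (f : ℤ → ℂ) (H : ∀ m n, (1 + S) * (q ^ n * q - q ^ m) * f (m + n) =
      -((1 + q ^ m) * f n * (1 - q ^ n * R))) (n : ℤ) :
    f n = 0 := by
  have hp : 1 + S ≠ 0 := fun h => h2 (by linear_combination h)
  have hm : 1 - S ≠ 0 := fun h => h1 (by linear_combination -h)
  have hq : q - 1 ≠ 0 := sub_ne_zero.2 hq1
  have key : ∀ n : ℤ, (q ^ n * ((1 + S) * q - 2 * R) + 1 - S) * f n = 0 := by
    intro n
    have := H 0 n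
    simp only [zpow_zero, zero_add] at this
    linear_combination this
  by_contra hn
  have hK : q ^ n * ((1 + S) * q - 2 * R) + 1 - S = 0 := (mul_eq_zero.1 (key n)).resolve_right hn
  have e1 : f (s + 1 + n) = 0 := by
    refine (mul_eq_zero.1 (key _)).resolve_left fun h => ?_
    rw [zpow_add₀ hq0, hS] at h
    exact mul_ne_zero hm hm (by linear_combination h - S * hK)
  have e2 : f (n - 1) = 0 := by
    refine (mul_eq_zero.1 (key _)).resolve_left fun h => ?_
    rw [zpow_sub₀ hq0, zpow_one] at h
    field_simp at h
    exact mul_ne_zero hq hm (by linear_combination h - hK)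
  have f1 := H (s + 1) n
  rw [e1, hS] at f1
  have g1 : 1 - q ^ n * R = 0 := by
    apply mul_left_cancel₀ (mul_ne_zero hp hn); linear_combination f1
  have g2 : q ^ n * q - 1 = 0 := by
    apply mul_left_cancel₀ hp; linear_combination hK - 2 * g1
  have f2 := H 1 (n - 1)
  rw [e2, zpow_sub₀ hq0, zpow_one, add_sub_cancel, div_mul_cancel₀ _ hq0] at f2
  have g3 : q ^ n - q = 0 := by
    apply mul_left_cancel₀ (mul_ne_zero hp hn); linear_combination f2
  -- now q ^ n = q, q ^ 2 = 1, q * R = 1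
  apply h1
  rw [hR]
  linear_combination -g1 - R * g3

end Scalar

lemma homOf_single (i : BIdx) (a : ℂ) : homOf i.parity (single i a) := by
  intro j hj
  have := Finsupp.support_single_subset hj
  rw [Finset.mem_singleton] at this
  rw [this]

lemma inner_is_der (q : ℂ) (hq0 : q ≠ 0) (hq1 : q ≠ 1) (s : ℤ)
    (hqs2 : q ^ (s + 1) ≠ -1) (A B : ℂ) (φ : BIdx → Aq)
    (hφ : ∀ i : BIdx, φ i = A • bk q (.G s) i + B • bk q (.T s) i) :
    IsOddQDerivation q s φ := by
  have hp : 1 + q ^ (s + 1) ≠ 0 := fun h => hqs2 (by linear_combination h)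
  have hq : 1 - q ≠ 0 := sub_ne_zero.2 hq1.symm
  refine ⟨fun n => ⟨?_, ?_, ?_, ?_⟩, fun px py x y hx hy => ?_⟩
  · rw [hφ, mem_spanGT, add_comm n s]
    simp only [bk, smul_single]
    exact ⟨_, _, rfl⟩
  · rw [hφ, mem_spanGT, add_comm n s]
    refine ⟨0, A * -(qnum q n), ?_⟩
    simp [bk]
  · rw [hφ]; simp [bk]
  · rw [hφ]; simp [bk]
  · refine der_of_basis q _ φ ?_ px x y hx
    intro i j a b
    rw [eq_inv_smul_iff₀ hp]
    rcases i with m | m | m | m <;> rcases j with n | n | n | n <;>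
      simp only [bkA_single, DA_single, alq_single, hφ, bk, smul_single, smul_zero, add_zero,
        zero_add, bkA_add_left, bkA_add_right, bkA_zero_left, bkA_zero_right, DA_zero, smul_add,
        acoef, sgn1, BIdx.parity, smul_eq_mul, if_true, if_false, Bool.false_eq_true] <;>
      simp only [add_assoc, add_left_comm m s n] <;>
      (ext k
       simp only [Finsupp.add_apply, Finsupp.single_apply, qnum, zpow_add₀ hq0, zpow_one]
       split_ifs <;> field_simp <;> ring)

lemma der_eqs (q : ℂ) (hq0 : q ≠ 0) (hq1 : q ≠ 1) (s : ℤ)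
    (hqs2 : q ^ (s + 1) ≠ -1) (φ : BIdx → Aq) (h : IsOddQDerivation q s φ) (i j : BIdx) :
    (1 + q ^ (s + 1)) • DA φ (bk q i j) =
      (bkA q (φ i) (single j (acoef q j)) +
        sgn1 i.parity • bkA q (single i (acoef q i)) (φ j)) := by
  have hp : 1 + q ^ (s + 1) ≠ 0 := fun h => hqs2 (by linear_combination h)
  have := h.2 _ _ (single i 1) (single j 1) (homOf_single i 1) (homOf_single j 1)
  rw [eq_inv_smul_iff₀ hp] at this
  simpa only [bkA_single, DA_single, alq_single, mul_one, one_smul] using this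


lemma der_is_inner (q : ℂ) (hq0 : q ≠ 0) (hq1 : q ≠ 1) (s : ℤ)
    (hqs1 : q ^ (s + 1) ≠ 1) (hqs2 : q ^ (s + 1) ≠ -1) (φ : BIdx → Aq)
    (hφ : IsOddQDerivation q s φ) :
    ∃ a b : ℂ, ∀ i : BIdx, φ i = a • bk q (.G s) i + b • bk q (.T s) i := by
  have E := der_eqs q hq0 hq1 s hqs2 φ hφ
  have hq : 1 - q ≠ 0 := sub_ne_zero.2 hq1.symm
  have hp : 1 + q ^ (s + 1) ≠ 0 := fun h => hqs2 (by linear_combination h)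
  have hm : 1 - q ^ (s + 1) ≠ 0 := fun h => hqs1 (by linear_combination -h)
  have hS0 : q ^ (s + 1) ≠ 0 := zpow_ne_zero _ hq0
  have hR : q ^ (s + 1) = q ^ s * q := zpow_add_one₀ hq0 s
  choose a b hL using fun n => mem_spanGT.1 (hφ.1 n).1
  choose c d hI using fun n => mem_spanGT.1 (hφ.1 n).2.1
  choose e f hG using fun n => mem_spanLI.1 (hφ.1 n).2.2.1
  choose g h hT using fun n => mem_spanLI.1 (hφ.1 n).2.2.2
  have i1 : ∀ m n : ℤ, m + s + n = m + n + s := fun m n => by ring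
  have i2 : ∀ m n : ℤ, m + (n + s) = m + n + s := fun m n => by ring
  have ELL : ∀ m n, _ := fun m n => E (.L m) (.L n)
  have ELI : ∀ m n, _ := fun m n => E (.L m) (.I n)
  have ELG : ∀ m n, _ := fun m n => E (.L m) (.G n)
  have EIG : ∀ m n, _ := fun m n => E (.I m) (.G n)
  simp only [bkA_single, DA_single, hL, hI, hG, hT, bk, smul_single, smul_zero, add_zero,
        zero_add, bkA_add_left, bkA_add_right, bkA_zero_left, bkA_zero_right, DA_zero, smul_add,
        acoef, sgn1, BIdx.parity, smul_eq_mul, if_true, if_false, Bool.false_eq_true, i1, i2]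
    at ELL ELI ELG EIG
  obtain ⟨κ, hκ, hqn⟩ : ∃ κ : ℂ, κ ≠ 0 ∧ ∀ n, qnum q n = (1 - q ^ n) * κ :=
    ⟨(1 - q)⁻¹, inv_ne_zero hq, fun n => rfl⟩
  have Ha : ∀ m n, (1 + q ^ (s + 1)) * (q ^ n - q ^ m) * a (m + n) =
      (1 + q ^ n) * a m * (q ^ n - q ^ m * q ^ (s + 1)) + (1 + q ^ m) * a n * (q ^ n * q ^ (s + 1) - q ^ m) := by
    intro m n
    have t := DFunLike.congr_fun (ELL m n) (BIdx.G (m + n + s))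
    simp only [Finsupp.add_apply, Finsupp.single_apply, reduceCtorEq, if_true, if_false, hqn,
      zpow_add₀ hq0 n, zpow_add₀ hq0 m, zpow_add₀ hq0 (n + 1), zpow_add₀ hq0 (m + 1), zpow_one,
      add_zero, zero_add, one_mul, hR] at t
    apply mul_left_cancel₀ hκ
    rw [hR]
    linear_combination t
  have Hb : ∀ m n, (1 + q ^ (s + 1)) * (q ^ n - q ^ m) * b (m + n) =
      (1 + q ^ n) * b m * (1 - q ^ m * q ^ (s + 1)) - (1 + q ^ m) * b n * (1 - q ^ n * q ^ (s + 1)) := by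
    intro m n
    have t := DFunLike.congr_fun (ELL m n) (BIdx.T (m + n + s))
    simp only [Finsupp.add_apply, Finsupp.single_apply, reduceCtorEq, if_true, if_false, hqn,
      zpow_add₀ hq0 n, zpow_add₀ hq0 m, zpow_add₀ hq0 (n + 1), zpow_add₀ hq0 (m + 1), zpow_one,
      add_zero, zero_add, one_mul, hR] at t
    apply mul_left_cancel₀ hκ
    rw [hR]
    linear_combination t
  have Hc : ∀ m n, -((1 + q ^ (s + 1)) * (1 - q ^ n)) * c (m + n) =
      (1 + q ^ m) * c n * (q ^ n * q ^ (s + 1) - q ^ m) := by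
    intro m n
    have t := DFunLike.congr_fun (ELI m n) (BIdx.G (m + n + s))
    simp only [Finsupp.add_apply, Finsupp.single_apply, reduceCtorEq, if_true, if_false, hqn,
      zpow_add₀ hq0 n, zpow_add₀ hq0 m, zpow_add₀ hq0 (n + 1), zpow_add₀ hq0 (m + 1), zpow_one,
      add_zero, zero_add, one_mul, hR] at t
    apply mul_left_cancel₀ hκ
    rw [hR]
    linear_combination t
  have Hd : ∀ m n, -((1 + q ^ (s + 1)) * (1 - q ^ n)) * d (m + n) =
      -((1 + q ^ n) * a m * (1 - q ^ n)) - (1 + q ^ m) * d n * (1 - q ^ n * q ^ (s + 1)) := by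
    intro m n
    have t := DFunLike.congr_fun (ELI m n) (BIdx.T (m + n + s))
    simp only [Finsupp.add_apply, Finsupp.single_apply, reduceCtorEq, if_true, if_false, hqn,
      zpow_add₀ hq0 n, zpow_add₀ hq0 m, zpow_add₀ hq0 (n + 1), zpow_add₀ hq0 (m + 1), zpow_one,
      add_zero, zero_add, one_mul, hR] at t
    apply mul_left_cancel₀ hκ
    rw [hR]
    linear_combination t
  have He : ∀ m n, (1 + q ^ (s + 1)) * (q ^ n * q - q ^ m) * e (m + n) =
      (1 + q ^ m) * e n * (q ^ n * q ^ s - q ^ m) := by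
    intro m n
    have t := DFunLike.congr_fun (ELG m n) (BIdx.L (m + n + s))
    simp only [Finsupp.add_apply, Finsupp.single_apply, reduceCtorEq, if_true, if_false, hqn,
      zpow_add₀ hq0 n, zpow_add₀ hq0 m, zpow_add₀ hq0 (n + 1), zpow_add₀ hq0 (m + 1), zpow_one,
      add_zero, zero_add, one_mul, hR] at t
    apply mul_left_cancel₀ hκ
    rw [hR]
    linear_combination t
  have Hf : ∀ m n, (1 + q ^ (s + 1)) * (q ^ n * q - q ^ m) * f (m + n) =
      -((1 + q ^ m) * f n * (1 - q ^ n * q ^ s)) := by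
    intro m n
    have t := DFunLike.congr_fun (ELG m n) (BIdx.I (m + n + s))
    simp only [Finsupp.add_apply, Finsupp.single_apply, reduceCtorEq, if_true, if_false, hqn,
      zpow_add₀ hq0 n, zpow_add₀ hq0 m, zpow_add₀ hq0 (n + 1), zpow_add₀ hq0 (m + 1), zpow_one,
      add_zero, zero_add, one_mul, hR] at t
    apply mul_left_cancel₀ hκ
    rw [hR]
    linear_combination t
  have Hg : ∀ m n, (1 + q ^ (s + 1)) * (1 - q ^ m) * g (m + n) = 0 := by
    intro m n
    have t := DFunLike.congr_fun (EIG m n) (BIdx.L (m + n + s))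
    simp only [Finsupp.add_apply, Finsupp.single_apply, reduceCtorEq, if_true, if_false, hqn,
      zpow_add₀ hq0 n, zpow_add₀ hq0 m, zpow_add₀ hq0 (n + 1), zpow_add₀ hq0 (m + 1), zpow_one,
      add_zero, zero_add, one_mul, hR] at t
    apply mul_left_cancel₀ hκ
    rw [hR]
    linear_combination t
  have Hh : ∀ m n, (1 + q ^ (s + 1)) * (1 - q ^ m) * h (m + n) =
      (1 + q ^ m) * e n * (1 - q ^ m) := by
    intro m n
    have t := DFunLike.congr_fun (EIG m n) (BIdx.I (m + n + s))
    simp only [Finsupp.add_apply, Finsupp.single_apply, reduceCtorEq, if_true, if_false, hqn,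
      zpow_add₀ hq0 n, zpow_add₀ hq0 m, zpow_add₀ hq0 (n + 1), zpow_add₀ hq0 (m + 1), zpow_one,
      add_zero, zero_add, one_mul, hR] at t
    apply mul_left_cancel₀ hκ
    rw [hR]
    linear_combination t
  have Ra := scal_a hq0 rfl hqs1 hqs2 hS0 a Ha
  have Rb := scal_b hq0 rfl hqs1 hqs2 b Hb
  have Rc := scal_c hq0 rfl hqs1 hqs2 hS0 c Hc
  have Rd := scal_d hq0 rfl hqs1 hqs2 a d Hd
  have Re := scal_e hq0 rfl hqs1 hqs2 hS0 e He
  have Rf := scal_f hq0 hq1 rfl hR hqs1 hqs2 f Hf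
  have Rg : ∀ n, g n = 0 := by
    intro n
    have t := Hg 1 (n - 1)
    rw [zpow_one, add_sub_cancel] at t
    exact (mul_eq_zero.1 t).resolve_left (mul_ne_zero hp hq)
  have Rh : ∀ n, h n = 0 := by
    intro n
    have t := Hh 1 (n - 1)
    rw [zpow_one, add_sub_cancel, Re, mul_zero, zero_mul] at t
    exact (mul_eq_zero.1 t).resolve_left (mul_ne_zero hp hq)
  refine ⟨a 0 / ((1 - q ^ (s + 1)) * κ), b 0 / ((1 - q ^ (s + 1)) * κ), ?_⟩
  rintro (n | n | n | n)
  · rw [hL, Rb n, eq_div_of_mul_eq hm (Ra n), add_comm n s]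
    simp only [bk, smul_single, smul_eq_mul, hqn]
    congr 2
    · field_simp; ring
    · field_simp
  · rw [hI, Rc n, eq_div_of_mul_eq hm (Rd n), add_comm n s]
    simp only [bk, smul_single, smul_eq_mul, hqn, single_zero, zero_add, smul_zero, add_zero]
    congr 1
    field_simp
  · rw [hG, Re, Rf]; simp [bk]
  · rw [hT, Rg, Rh]; simp [bk]

/-- for `s ≠ −1` with `q^{s+1} ≠ 1` and `q^{s+1} ≠ −1`, the space of odd
`q`-derivations of `𝔄_q` homogeneous of degree `s` equals the span of the inner
derivations `ad_{G_s}` and `ad_{T_s}`. -/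
theorem odd_q_derivations_are_inner
    (q : ℂ) (hq0 : q ≠ 0) (hq1 : q ≠ 1) (s : ℤ) (hs : s ≠ -1)
    (hqs1 : q ^ (s + 1) ≠ 1) (hqs2 : q ^ (s + 1) ≠ -1) :
    ∀ φ : BIdx → Aq, IsOddQDerivation q s φ ↔
      ∃ a b : ℂ, ∀ i : BIdx, φ i = a • bk q (.G s) i + b • bk q (.T s) i := by
  intro φ
  constructor
  · exact der_is_inner q hq0 hq1 s hqs1 hqs2 φ
  · rintro ⟨a, b, h⟩
    exact inner_is_der q hq0 hq1 s hqs2 a b φ h
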